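/- Let G be a finite group, θ : G → G an involutive automorphism, and H ⊆ G a subgroup. Then the following are equivalent: (1) every irreducible complex representation π of G satisfies dim(π^H) · (dim(π^{θ(H)}) − ε_θ(π)) = 0, i.e., for every π either π^H = 0, or dim(π^{θ(H)}) = ε_θ(π); (2) every (H, θ(H))-double coset O ⊆ G satisfies σ(O) = O, where σ(g) = θ(g⁻¹), i.e., for every g ∈ G there exist h₁, h₂ ∈ H such that h₁ g⁻¹ θ(h₂) = θ(g). -/

import Mathlib

open scoped Classical TensorProduct

noncomputable section

namespace GK

variable {G : Type} [Group G]

/-- A complex representation is irreducible if it is nonzero and has no invariant subspaces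
other than `⊥` and `⊤`. -/
def IsIrred {V : Type} [AddCommGroup V] [Module ℂ V] (π : Representation ℂ G V) : Prop :=
  (⊥ : Submodule ℂ V) ≠ ⊤ ∧
    ∀ W : Submodule ℂ V, (∀ (g : G), ∀ v ∈ W, π g v ∈ W) → W = ⊥ ∨ W = ⊤

/-- The subspace `π^H` of vectors invariant under a subgroup `H`. -/
def invariantsOf {V : Type} [AddCommGroup V] [Module ℂ V] (π : Representation ℂ G V)
    (H : Subgroup G) : Submodule ℂ V where
  carrier := {v | ∀ h ∈ H, π h v = v}
  add_mem' := by
    intro a b ha hb h hh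
    simp [map_add, ha h hh, hb h hh]
  zero_mem' := by
    intro h hh
    simp
  smul_mem' := by
    intro c v hv h hh
    simp [map_smul, hv h hh]

/-- `(G, H)` is a Gelfand pair: every irreducible complex representation of `G` has at most
one-dimensional space of `H`-invariant vectors. -/
def IsGelfandPair (G : Type) [Group G] (H : Subgroup G) : Prop :=
  ∀ (V : Type) [AddCommGroup V] [Module ℂ V] [FiniteDimensional ℂ V]
    (π : Representation ℂ G V), IsIrred π →
      Module.finrank ℂ (invariantsOf π H) ≤ 1

/-- Isomorphism of representations. -/
def RepIso {V W : Type} [AddCommGroup V] [Module ℂ V] [AddCommGroup W] [Module ℂ W]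
    (π : Representation ℂ G V) (τ : Representation ℂ G W) : Prop :=
  ∃ e : V ≃ₗ[ℂ] W, ∀ (g : G) (v : V), e (π g v) = τ g (e v)

/-- `π ∘ θ ≅ π*`: the θ-twist of `π` is isomorphic to the dual (contragredient)
representation of `π`. -/
def ConjThetaIsoDual {V : Type} [AddCommGroup V] [Module ℂ V] (θ : G ≃* G)
    (π : Representation ℂ G V) : Prop :=
  RepIso (MonoidHom.comp π θ.toMonoidHom) π.dual

/-- `π` possesses a nonzero symmetric bilinear form `B` with
`B(π(g)v, w) = B(v, π(θ(g⁻¹))w)`. -/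
def HasSymForm {V : Type} [AddCommGroup V] [Module ℂ V] (θ : G ≃* G)
    (π : Representation ℂ G V) : Prop :=
  ∃ B : V →ₗ[ℂ] V →ₗ[ℂ] ℂ, B ≠ 0 ∧ (∀ v w, B v w = B w v) ∧
    ∀ (g : G) (v w : V), B (π g v) w = B v (π (θ g⁻¹) w)

/-- `π` possesses a nonzero antisymmetric bilinear form `B` with
`B(π(g)v, w) = B(v, π(θ(g⁻¹))w)`. -/
def HasAltForm {V : Type} [AddCommGroup V] [Module ℂ V] (θ : G ≃* G)
    (π : Representation ℂ G V) : Prop :=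
  ∃ B : V →ₗ[ℂ] V →ₗ[ℂ] ℂ, B ≠ 0 ∧ (∀ v w, B v w = - B w v) ∧
    ∀ (g : G) (v w : V), B (π g v) w = B v (π (θ g⁻¹) w)

/-- The twisted Frobenius–Schur indicator `ε_θ(π)`: `1` if `π` has a nonzero symmetric
θ-twisted invariant bilinear form, `-1` if it has a nonzero antisymmetric one, and `0`
otherwise (for irreducible `π` this last case is exactly `π ∘ θ ≇ π*`). -/
def eps {V : Type} [AddCommGroup V] [Module ℂ V] (θ : G ≃* G)
    (π : Representation ℂ G V) : ℤ :=
  if HasSymForm θ π then 1 else if HasAltForm θ π then -1 else 0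

end GK

namespace GK

variable {G : Type} [Group G] {V : Type} [AddCommGroup V] [Module ℂ V]

/-- A proper invariant subspace of an irreducible representation vanishes. -/
lemma IsIrred.eq_bot {π : Representation ℂ G V} (hπ : IsIrred π) {W : Submodule ℂ V}
    (hW : ∀ g : G, ∀ v ∈ W, π g v ∈ W) (hne : W ≠ ⊤) : W = ⊥ :=
  (hπ.2 W hW).resolve_right hne

/-- A nonzero vector of an irreducible representation is cyclic. -/
lemma IsIrred.span_orbit_eq_top {π : Representation ℂ G V} (hπ : IsIrred π) {w : V}
    (hw : w ≠ 0) : Submodule.span ℂ (Set.range fun g : G => π g w) = ⊤ := by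
  have hmem : w ∈ Submodule.span ℂ (Set.range fun g : G => π g w) :=
    Submodule.subset_span ⟨1, by simp⟩
  refine (hπ.2 _ fun g v hv => ?_).resolve_left fun h => hw (by simpa [h] using hmem)
  induction hv using Submodule.span_induction with
  | mem x hx =>
    obtain ⟨a, rfl⟩ := hx
    exact Submodule.subset_span ⟨g * a, by simp⟩
  | zero => simp
  | add x y _ _ hx hy => rw [map_add]; exact Submodule.add_mem _ hx hy
  | smul c x _ hx => rw [map_smul]; exact Submodule.smul_mem _ c hx

/-- The invariance property of the bilinear forms defining the twisted indicator. -/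
def IsTwistedInvariant (θ : G ≃* G) (π : Representation ℂ G V) (B : V →ₗ[ℂ] V →ₗ[ℂ] ℂ) : Prop :=
  ∀ (g : G) (v w : V), B (π g v) w = B v (π (θ g⁻¹) w)

lemma IsTwistedInvariant.injective {θ : G ≃* G} {π : Representation ℂ G V} (hπ : IsIrred π)
    {B : V →ₗ[ℂ] V →ₗ[ℂ] ℂ} (hB : IsTwistedInvariant θ π B) (hne : B ≠ 0) :
    Function.Injective B := by
  rw [← LinearMap.ker_eq_bot]
  refine hπ.eq_bot (fun g v hv => ?_) fun h => hne (LinearMap.ker_eq_top.mp h)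
  rw [LinearMap.mem_ker] at hv ⊢
  ext w
  rw [hB, hv]
  rfl

lemma IsTwistedInvariant.surjective [FiniteDimensional ℂ V] {θ : G ≃* G}
    {π : Representation ℂ G V} (hπ : IsIrred π) {B : V →ₗ[ℂ] V →ₗ[ℂ] ℂ}
    (hB : IsTwistedInvariant θ π B) (hne : B ≠ 0) : Function.Surjective B :=
  (LinearMap.injective_iff_surjective_of_finrank_eq_finrank
    (Subspace.dual_finrank_eq (K := ℂ) (V := V)).symm).mp (hB.injective hπ hne)

/-- Schur's lemma: twisted invariant forms on an irreducible representation are unique up to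
scalars. -/
lemma IsTwistedInvariant.exists_eq_smul [FiniteDimensional ℂ V] {θ : G ≃* G}
    {π : Representation ℂ G V} (hπ : IsIrred π) {B C : V →ₗ[ℂ] V →ₗ[ℂ] ℂ}
    (hB : IsTwistedInvariant θ π B) (hC : IsTwistedInvariant θ π C) (hne : C ≠ 0) :
    ∃ c : ℂ, B = c • C := by
  have : Nontrivial V := by
    by_contra h
    rw [not_nontrivial_iff_subsingleton] at h
    exact hπ.1 (Subsingleton.elim _ _)
  let e : V ≃ₗ[ℂ] (V →ₗ[ℂ] ℂ) :=
    LinearEquiv.ofBijective C ⟨hC.injective hπ hne, hC.surjective hπ hne⟩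
  obtain ⟨c, hc⟩ := Module.End.exists_eigenvalue (e.symm.toLinearMap ∘ₗ B)
  obtain ⟨v, hv, hv0⟩ := hc.exists_hasEigenvector
  rw [Module.End.mem_eigenspace_iff] at hv
  have hBv : B v = c • C v := by
    rw [LinearMap.comp_apply, LinearEquiv.coe_coe, LinearEquiv.symm_apply_eq, map_smul] at hv
    exact hv
  refine ⟨c, ?_⟩
  by_contra h
  have hinv : IsTwistedInvariant θ π (B - c • C) := fun g v w => by
    simp [hB g v w, hC g v w]
  refine hv0 (hinv.injective hπ (sub_ne_zero.mpr h) ?_)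
  simp [hBv]

/-- A vector representing an `H`-invariant functional through a twisted invariant form is
`θ(H)`-invariant. -/
lemma IsTwistedInvariant.mem_invariantsOf_map [FiniteDimensional ℂ V] {θ : G ≃* G}
    (hθ : ∀ g : G, θ (θ g) = g) {π : Representation ℂ G V} (hπ : IsIrred π)
    {B : V →ₗ[ℂ] V →ₗ[ℂ] ℂ} (hB : IsTwistedInvariant θ π B) (hne : B ≠ 0) {H : Subgroup G}
    {w : V} (hw : ∀ h ∈ H, ∀ u, B w (π h u) = B w u) :
    w ∈ invariantsOf π (H.map θ.toMonoidHom) := by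
  rintro _ ⟨h, hh, rfl⟩
  refine hB.injective hπ hne (LinearMap.ext fun u => ?_)
  have := hB (θ h) w u
  rw [← map_inv, hθ] at this
  exact this.trans (hw _ (H.inv_mem hh) u)

/-- A functional and a vector whose matrix coefficient is invariant under `g ↦ θ(g⁻¹)` define a
symmetric twisted invariant form. -/
lemma exists_symm_form {θ : G ≃* G} (hθ : ∀ g : G, θ (θ g) = g)
    {π : Representation ℂ G V} (hπ : IsIrred π) {l : V →ₗ[ℂ] ℂ} {w : V} (hw : w ≠ 0)
    (hlw : ∀ g, l (π g w) = l (π (θ g⁻¹) w)) :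
    ∃ B : V →ₗ[ℂ] V →ₗ[ℂ] ℂ, B w = l ∧ (∀ u v, B u v = B v u) ∧ IsTwistedInvariant θ π B := by
  have hspan := hπ.span_orbit_eq_top hw
  let Φ : (G →₀ ℂ) →ₗ[ℂ] V := Finsupp.linearCombination ℂ fun g => π g w
  let Ψ : (G →₀ ℂ) →ₗ[ℂ] V →ₗ[ℂ] ℂ := Finsupp.linearCombination ℂ fun g => l ∘ₗ π (θ g⁻¹)
  have hΦ : LinearMap.range Φ = ⊤ := by rw [Finsupp.range_linearCombination, hspan]
  have hΨ (b : G) (c : G →₀ ℂ) : Ψ c (π b w) = l (π (θ b⁻¹) (Φ c)) := by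
    induction c using Finsupp.induction_linear with
    | zero => simp
    | add x y hx hy => simp [hx, hy]
    | single a r =>
      have h := hlw (θ a⁻¹ * b)
      simp only [mul_inv_rev, map_mul, map_inv, hθ, inv_inv, Module.End.mul_apply] at h
      simp [Φ, Ψ, h]
  obtain ⟨s, hs⟩ := Φ.exists_rightInverse_of_surjective hΦ
  have hker (c : G →₀ ℂ) (hc : Φ c = 0) : Ψ c = 0 :=
    LinearMap.ext_on_range hspan fun b => by simp [hΨ, hc]
  have hB (a : G) : (Ψ ∘ₗ s) (π a w) = l ∘ₗ π (θ a⁻¹) := by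
    have h := hker (s (π a w) - Finsupp.single a 1) (by
      rw [map_sub, ← LinearMap.comp_apply, hs]
      simp [Φ])
    rw [map_sub, sub_eq_zero] at h
    rw [LinearMap.comp_apply, h]
    simp [Ψ]
  refine ⟨Ψ ∘ₗ s, by simpa [Module.End.one_eq_id] using hB 1, fun u v => ?_, fun g v u => ?_⟩
  · have h : Ψ ∘ₗ s = (Ψ ∘ₗ s).flip :=
      LinearMap.ext_on_range hspan fun a => LinearMap.ext_on_range hspan fun b => by
        rw [LinearMap.flip_apply, hB, hB]
        have h := hlw (θ a⁻¹ * b)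
        simpa [hθ] using h
    exact LinearMap.congr_fun₂ h u v
  · have h : (Ψ ∘ₗ s) ∘ₗ π g = (LinearMap.lcomp ℂ ℂ (π (θ g⁻¹))) ∘ₗ (Ψ ∘ₗ s) :=
      LinearMap.ext_on_range hspan fun a => by
        rw [LinearMap.comp_apply _ (π g), LinearMap.comp_apply (LinearMap.lcomp _ _ _),
          ← Module.End.mul_apply, ← map_mul, hB, hB]
        ext u
        simp
    exact LinearMap.congr_fun₂ h v u

section Average

variable [Fintype G] (π : Representation ℂ G V) (H : Subgroup G)

lemma sum_mem_invariantsOf (u : V) : ∑ h : H, π h u ∈ invariantsOf π H := by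
  intro k hk
  rw [map_sum]
  exact Fintype.sum_equiv (Equiv.mulLeft (⟨k, hk⟩ : H)) _ _ fun h => by simp

lemma exists_invariant_functional (h : invariantsOf π H ≠ ⊥) :
    ∃ l : V →ₗ[ℂ] ℂ, l ≠ 0 ∧ ∀ h ∈ H, ∀ u, l (π h u) = l u := by
  obtain ⟨v, hv, hv0⟩ := Submodule.exists_mem_ne_zero_of_ne_bot h
  obtain ⟨μ, hμ⟩ : ∃ μ : V →ₗ[ℂ] ℂ, μ v ≠ 0 := by
    by_contra! h
    exact hv0 ((Module.forall_dual_apply_eq_zero_iff ℂ v).mp h)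
  refine ⟨∑ h : H, μ ∘ₗ π h, fun h0 => ?_, fun k hk u => ?_⟩
  · have h1 : ∀ h : H, π h v = v := fun h => hv h h.2
    have h2 := LinearMap.congr_fun h0 v
    simp [h1, hμ] at h2
  · simp only [LinearMap.sum_apply, LinearMap.comp_apply]
    exact Fintype.sum_equiv (Equiv.mulRight (⟨k, hk⟩ : H)) _ _ fun h => by simp

lemma invariantsOf_ne_bot {l : V →ₗ[ℂ] ℂ} (hl : l ≠ 0) (hinv : ∀ h ∈ H, ∀ u, l (π h u) = l u) :
    invariantsOf π H ≠ ⊥ := by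
  intro hbot
  obtain ⟨u, hu⟩ : ∃ u, l u ≠ 0 := by
    by_contra! h
    exact hl (LinearMap.ext h)
  have h0 := sum_mem_invariantsOf π H u
  rw [hbot, Submodule.mem_bot] at h0
  have h1 : ∀ h : H, l (π h u) = l u := fun h => hinv h h.2 u
  have h2 := congrArg l h0
  simp [h1, hu] at h2

end Average

/-- All matrix coefficients of `π` coming from an `H`-invariant functional and a
`θ(H)`-invariant vector are invariant under `g ↦ θ(g⁻¹)`. -/
def CoeffsFixed (θ : G ≃* G) (H : Subgroup G) (π : Representation ℂ G V) : Prop :=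
  ∀ l : V →ₗ[ℂ] ℂ, (∀ h ∈ H, ∀ u, l (π h u) = l u) →
    ∀ w ∈ invariantsOf π (H.map θ.toMonoidHom), ∀ g, l (π g w) = l (π (θ g⁻¹) w)

lemma coeffsFixed_of_fixed_dosets {θ : G ≃* G} {H : Subgroup G}
    (hfix : ∀ g : G, ∃ h₁ ∈ H, ∃ h₂ ∈ H, h₁ * g⁻¹ * θ h₂ = θ g)
    (π : Representation ℂ G V) : CoeffsFixed θ H π := by
  intro l hl w hw g
  obtain ⟨h₁, hh₁, h₂, hh₂, h⟩ := hfix g⁻¹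
  have hw₂ : π (θ h₂) w = w := hw _ ⟨h₂, hh₂, rfl⟩
  rw [← h, inv_inv, map_mul, map_mul, Module.End.mul_apply, Module.End.mul_apply, hw₂,
    hl _ hh₁]

/-- The multiplicity identity of a single irreducible representation, from the symmetry of its
matrix coefficients. -/
lemma CoeffsFixed.multiplicity [Fintype G] [FiniteDimensional ℂ V] {θ : G ≃* G}
    (hθ : ∀ g : G, θ (θ g) = g) {H : Subgroup G} {π : Representation ℂ G V} (hπ : IsIrred π)
    (hc : CoeffsFixed θ H π) :
    (Module.finrank ℂ (invariantsOf π H) : ℤ) *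
      ((Module.finrank ℂ (invariantsOf π (H.map θ.toMonoidHom)) : ℤ) - eps θ π) = 0 := by
  by_cases hH : invariantsOf π H = ⊥
  · simp [hH]
  obtain ⟨l, hl0, hl⟩ := exists_invariant_functional π H hH
  rw [mul_eq_zero, sub_eq_zero]
  right
  by_cases hK : invariantsOf π (H.map θ.toMonoidHom) = ⊥
  · have hno (B : V →ₗ[ℂ] V →ₗ[ℂ] ℂ) (hne : B ≠ 0) (hB : IsTwistedInvariant θ π B) : False := by
      obtain ⟨w, rfl⟩ := hB.surjective hπ hne l
      have hw := hB.mem_invariantsOf_map hθ hπ hne hl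
      rw [hK, Submodule.mem_bot] at hw
      exact hl0 (by simp [hw])
    have hs : ¬ HasSymForm θ π := fun ⟨B, hne, _, hB⟩ => hno B hne hB
    have ha : ¬ HasAltForm θ π := fun ⟨B, hne, _, hB⟩ => hno B hne hB
    rw [hK, eps, if_neg hs, if_neg ha, finrank_bot, Nat.cast_zero]
  · obtain ⟨w, hw, hw0⟩ := Submodule.exists_mem_ne_zero_of_ne_bot hK
    obtain ⟨B, rfl, hsymm, hB⟩ := exists_symm_form hθ hπ hw0 (hc l hl w hw)
    have hne : B ≠ 0 := fun h => hl0 (by simp [h])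
    have hs : HasSymForm θ π := ⟨B, hne, hsymm, hB⟩
    rw [eps, if_pos hs, Nat.cast_eq_one,
      finrank_eq_one_iff_of_nonzero' (⟨w, hw⟩ : invariantsOf π (H.map θ.toMonoidHom))
        (fun h => hw0 (congrArg Subtype.val h))]
    rintro ⟨u, hu⟩
    by_cases hu0 : u = 0
    · exact ⟨0, Subtype.ext ((zero_smul ℂ w).trans hu0.symm)⟩
    obtain ⟨C, hCu, -, hC⟩ := exists_symm_form hθ hπ hu0 (hc _ hl u hu)
    have hCne : C ≠ 0 := fun h => hl0 (by rw [← hCu, h]; rfl)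
    obtain ⟨c, rfl⟩ := hB.exists_eq_smul hπ hC hCne
    exact ⟨c, Subtype.ext (hC.injective hπ hCne ((map_smul C c w).trans hCu.symm))⟩

/-- The multiplicity identity of a single irreducible representation gives the symmetry of its
matrix coefficients. -/
lemma coeffsFixed_of_multiplicity [Fintype G] [FiniteDimensional ℂ V] {θ : G ≃* G}
    (hθ : ∀ g : G, θ (θ g) = g) {H : Subgroup G} {π : Representation ℂ G V} (hπ : IsIrred π)
    (hm : (Module.finrank ℂ (invariantsOf π H) : ℤ) *
      ((Module.finrank ℂ (invariantsOf π (H.map θ.toMonoidHom)) : ℤ) - eps θ π) = 0) :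
    CoeffsFixed θ H π := by
  intro l hl w hw g
  by_cases hl0 : l = 0
  · simp [hl0]
  by_cases hw0 : w = 0
  · simp [hw0]
  have hH := invariantsOf_ne_bot π H hl0 hl
  have hpos : 0 < Module.finrank ℂ (invariantsOf π (H.map θ.toMonoidHom)) := by
    rw [Module.finrank_pos_iff_exists_ne_zero]
    exact ⟨⟨w, hw⟩, fun h => hw0 (congrArg Subtype.val h)⟩
  have heps : (Module.finrank ℂ (invariantsOf π (H.map θ.toMonoidHom)) : ℤ) = eps θ π := by
    refine sub_eq_zero.mp ((mul_eq_zero.mp hm).resolve_left fun h => hH ?_)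
    exact Submodule.finrank_eq_zero.mp (by exact_mod_cast h)
  have hs : HasSymForm θ π := by
    by_contra hs
    rw [eps, if_neg hs] at heps
    split_ifs at heps
    all_goals omega
  rw [eps, if_pos hs, Nat.cast_eq_one,
    finrank_eq_one_iff_of_nonzero' (⟨w, hw⟩ : invariantsOf π (H.map θ.toMonoidHom))
      (fun h => hw0 (congrArg Subtype.val h))] at heps
  obtain ⟨B, hne, hsymm, hB⟩ := hs
  obtain ⟨u, rfl⟩ := IsTwistedInvariant.surjective hπ hB hne l
  obtain ⟨c, hc⟩ := heps ⟨u, IsTwistedInvariant.mem_invariantsOf_map hθ hπ hB hne hl⟩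
  obtain rfl : c • w = u := congrArg Subtype.val hc
  rw [map_smul, LinearMap.smul_apply, LinearMap.smul_apply, hsymm w, hB]

/-- The symmetry of matrix coefficients passes from irreducible representations to all
finite-dimensional ones, by complete reducibility. -/
lemma coeffsFixed_of_forall_irred [Fintype G] {θ : G ≃* G} {H : Subgroup G}
    (hirr : ∀ (V : Type) [AddCommGroup V] [Module ℂ V] [FiniteDimensional ℂ V]
      (π : Representation ℂ G V), IsIrred π → CoeffsFixed θ H π)
    (n : ℕ) : ∀ (V : Type) [AddCommGroup V] [Module ℂ V] [FiniteDimensional ℂ V]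
      (π : Representation ℂ G V), Module.finrank ℂ V = n → CoeffsFixed θ H π := by
  induction n using Nat.strong_induction_on with
  | _ n ih =>
  intro V _ _ _ π hn
  by_cases hπ : IsIrred π
  · exact hirr V π hπ
  by_cases hbt : (⊥ : Submodule ℂ V) = ⊤
  · intro l hl w hw g
    have hw0 : w = 0 := by
      rw [← Submodule.mem_bot ℂ, hbt]
      trivial
    simp [hw0]
  obtain ⟨W, hW, hWb, hWt⟩ : ∃ W : Submodule ℂ V,
      (∀ (g : G), ∀ v ∈ W, π g v ∈ W) ∧ W ≠ ⊥ ∧ W ≠ ⊤ := by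
    by_contra! h
    exact hπ ⟨hbt, fun W hW => or_iff_not_imp_left.mpr (h W hW)⟩
  have : NeZero (Nat.card G : ℂ) := ⟨by simp⟩
  obtain ⟨U, hU⟩ := exists_isCompl (⟨W, hW⟩ : Subrepresentation π)
  have hdisj : W ⊓ U.toSubmodule = ⊥ := congrArg Subrepresentation.toSubmodule hU.inf_eq_bot
  have htop : W ⊔ U.toSubmodule = ⊤ := congrArg Subrepresentation.toSubmodule hU.sup_eq_top
  have hUt : U.toSubmodule ≠ ⊤ := fun h => hWb (by simpa [h] using hdisj)
  have key (S : Subrepresentation π) (hS : S.toSubmodule ≠ ⊤) :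
      CoeffsFixed θ H S.toRepresentation :=
    ih _ (hn ▸ Submodule.finrank_lt hS) _ _ rfl
  have part (S : Subrepresentation π) (hS : S.toSubmodule ≠ ⊤) (l : V →ₗ[ℂ] ℂ)
      (hl : ∀ h ∈ H, ∀ u, l (π h u) = l u) (w : V) (hwS : w ∈ S.toSubmodule)
      (hw : w ∈ invariantsOf π (H.map θ.toMonoidHom)) (g : G) :
      l (π g w) = l (π (θ g⁻¹) w) :=
    key S hS (l ∘ₗ S.toSubmodule.subtype) (fun h hh u => hl h hh u) ⟨w, hwS⟩
      (fun h hh => Subtype.ext (hw h hh)) g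
  intro l hl w hw g
  obtain ⟨x, hx, y, hy, rfl⟩ :=
    Submodule.mem_sup.mp (htop ▸ Submodule.mem_top : w ∈ W ⊔ U.toSubmodule)
  have hxy (k : G) (hk : k ∈ H.map θ.toMonoidHom) : π k x - x = 0 := by
    have h := hw k hk
    rw [map_add] at h
    have hmem : π k x - x ∈ U.toSubmodule := by
      have h' : π k x - x = y - π k y := by
        rw [sub_eq_sub_iff_add_eq_add, h, add_comm]
      rw [h']
      exact sub_mem hy (U.apply_mem_toSubmodule k hy)
    rw [← Submodule.mem_bot ℂ, ← hdisj]
    exact ⟨sub_mem (hW k x hx) hx, hmem⟩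
  have hxinv : x ∈ invariantsOf π (H.map θ.toMonoidHom) := fun k hk => sub_eq_zero.mp (hxy k hk)
  have hyinv : y ∈ invariantsOf π (H.map θ.toMonoidHom) := by
    simpa using sub_mem hw hxinv
  simp only [map_add]
  rw [part ⟨W, hW⟩ hWt l hl x hx hxinv g, part U hUt l hl y hy hyinv g]

/-- The left regular representation on functions. -/
def functionRep (G : Type) [Group G] : Representation ℂ G (G → ℂ) where
  toFun g := LinearMap.funLeft ℂ ℂ fun x => g⁻¹ * x
  map_one' := by ext; simp [LinearMap.funLeft]
  map_mul' a b := by ext; simp [LinearMap.funLeft, mul_assoc]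

lemma functionRep_apply (g : G) (f : G → ℂ) (x : G) : functionRep G g f x = f (g⁻¹ * x) := rfl

/-- If the matrix coefficients of the regular representation are symmetric, then every double
coset is fixed. -/
lemma CoeffsFixed.fixed_dosets [Fintype G] {θ : G ≃* G} {H : Subgroup G}
    (hc : CoeffsFixed θ H (functionRep G)) (g : G) :
    ∃ h₁ ∈ H, ∃ h₂ ∈ H, h₁ * g⁻¹ * θ h₂ = θ g := by
  let K := H.map θ.toMonoidHom
  let l : (G → ℂ) →ₗ[ℂ] ℂ := ∑ h : H, LinearMap.proj (h * g⁻¹ : G)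
  have hl_apply (f : G → ℂ) : l f = ∑ h : H, f (h * g⁻¹) := by simp [l]
  let w : G → ℂ := fun x => if x ∈ K then 1 else 0
  have hl : ∀ k ∈ H, ∀ f, l (functionRep G k f) = l f := by
    intro k hk f
    rw [hl_apply, hl_apply]
    exact Fintype.sum_equiv (Equiv.mulLeft (⟨k, hk⟩⁻¹ : H)) _ _ fun h => by
      simp [functionRep_apply, mul_assoc]
  have hw : w ∈ invariantsOf (functionRep G) K := by
    intro k hk
    ext x
    simp only [functionRep_apply, w, K.mul_mem_cancel_left (K.inv_mem hk)]
  have hcoeff (a : G) : l (functionRep G a w) =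
      ((Finset.univ.filter fun h : H => a⁻¹ * (h * g⁻¹) ∈ K).card : ℂ) := by
    rw [hl_apply]
    simp [functionRep_apply, w]
  have h := hc l hl w hw g⁻¹
  rw [hcoeff, hcoeff, Nat.cast_inj] at h
  have hpos : 0 < (Finset.univ.filter fun h : H => g⁻¹⁻¹ * (h * g⁻¹) ∈ K).card :=
    Finset.card_pos.mpr ⟨1, by simp⟩
  rw [h] at hpos
  obtain ⟨k, hk⟩ := Finset.card_pos.mp hpos
  obtain ⟨h₂, hh₂, hk₂⟩ := (Finset.mem_filter.mp hk).2
  replace hk₂ : θ h₂ = (θ g⁻¹⁻¹)⁻¹ * (k * g⁻¹) := hk₂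
  refine ⟨k, k.2, h₂⁻¹, H.inv_mem hh₂, ?_⟩
  rw [map_inv, hk₂]
  simp [mul_assoc]

end GK

/-- Every irreducible `π` satisfies
`dim(π^H)·(dim(π^{θ(H)}) − ε_θ(π)) = 0` iff every `(H, θ(H))`-double coset is fixed by
`σ(g) = θ(g⁻¹)`, i.e. for every `g` there are `h₁, h₂ ∈ H` with `h₁ g⁻¹ θ(h₂) = θ(g)`. -/
theorem multiplicity_identity_iff_fixed_dosets {G : Type} [Group G] [Fintype G]
    (θ : G ≃* G) (hθ : ∀ g : G, θ (θ g) = g)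
    (H : Subgroup G) :
    (∀ (V : Type) [AddCommGroup V] [Module ℂ V] [FiniteDimensional ℂ V]
        (π : Representation ℂ G V), GK.IsIrred π →
          (Module.finrank ℂ (GK.invariantsOf π H) : ℤ) *
            ((Module.finrank ℂ (GK.invariantsOf π (H.map θ.toMonoidHom)) : ℤ) - GK.eps θ π)
            = 0) ↔
    ∀ g : G, ∃ h₁ ∈ H, ∃ h₂ ∈ H, h₁ * g⁻¹ * θ h₂ = θ g := by
  constructor
  · intro hmult
    exact (GK.coeffsFixed_of_forall_irred
      (fun V _ _ _ π hπ => GK.coeffsFixed_of_multiplicity hθ hπ (hmult V π hπ))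
      _ _ (GK.functionRep G) rfl).fixed_dosets
  · intro hfix V _ _ _ π hπ
    exact (GK.coeffsFixed_of_fixed_dosets hfix π).multiplicity hθ hπ
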